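/- arXiv:2209.13568 — 3 statements merged into one kernel-verified Lean document; each statement's English description precedes it below -/
import Mathlib

section
/- Let p ∈ (1,∞). There exist constants c_p, C_p > 0 such that for all a, b ∈ ℝ one has c_p·(b^{⟨p/2⟩} − a^{⟨p/2⟩})² ≤ F_p(a,b) ≤ C_p·(b^{⟨p/2⟩} − a^{⟨p/2⟩})². -/
/-- Signed power: `a^{⟨κ⟩} := |a|^κ · sgn a`. -/
noncomputable def spow (a κ : ℝ) : ℝ := |a| ^ κ * Real.sign a

/-- Bregman divergence `F_p(a,b) := |b|^p − |a|^p − p·a^{⟨p−1⟩}·(b−a)`. -/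
noncomputable def bregman (p a b : ℝ) : ℝ :=
  |b| ^ p - |a| ^ p - p * spow a (p - 1) * (b - a)

theorem spow_mul (a b κ : ℝ) : spow (a * b) κ = spow a κ * spow b κ := by
  have hsign : Real.sign (a * b) = Real.sign a * Real.sign b := by
    rcases lt_trichotomy a 0 with ha | rfl | ha <;> rcases lt_trichotomy b 0 with hb | rfl | hb <;>
      simp [Real.sign_of_neg, Real.sign_of_pos, mul_pos_of_neg_of_neg, mul_neg_of_pos_of_neg,
        mul_neg_of_neg_of_pos, *]
  rw [spow, spow, spow, abs_mul, Real.mul_rpow (abs_nonneg a) (abs_nonneg b), hsign]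
  ring

theorem spow_of_pos {a : ℝ} (ha : 0 < a) (κ : ℝ) : spow a κ = a ^ κ := by
  simp [spow, abs_of_pos ha, Real.sign_of_pos ha]

theorem spow_of_neg {a : ℝ} (ha : a < 0) (κ : ℝ) : spow a κ = -(-a) ^ κ := by
  simp [spow, abs_of_neg ha, Real.sign_of_neg ha]

theorem spow_zero_left (κ : ℝ) : spow 0 κ = 0 := by
  simp [spow]

theorem spow_sub_one_mul_self {a : ℝ} (ha : a ≠ 0) (p : ℝ) : spow a (p - 1) * a = |a| ^ p := by
  rcases ha.lt_or_gt with h | h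
  · rw [spow_of_neg h, abs_of_neg h, Real.rpow_sub_one (by linarith)]
    field_simp
  · rw [spow_of_pos h, abs_of_pos h, Real.rpow_sub_one ha]
    field_simp

theorem spow_half_sq {a : ℝ} (ha : a ≠ 0) (p : ℝ) : spow a (p / 2) ^ 2 = |a| ^ p := by
  have hsign : Real.sign a ^ 2 = 1 := by
    rcases Real.sign_apply_eq_of_ne_zero a ha with h | h <;> simp [h]
  rw [spow, mul_pow, hsign, mul_one, ← Real.rpow_natCast, ← Real.rpow_mul (abs_nonneg a)]
  norm_num

theorem bregman_mul {a : ℝ} (ha : a ≠ 0) (p t : ℝ) :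
    bregman p a (a * t) = |a| ^ p * (|t| ^ p - 1 - p * (t - 1)) := by
  rw [bregman, abs_mul, Real.mul_rpow (abs_nonneg a) (abs_nonneg t)]
  linear_combination (-p * (t - 1)) * spow_sub_one_mul_self ha p

theorem sq_spow_half_mul_sub {a : ℝ} (ha : a ≠ 0) (p t : ℝ) :
    (spow (a * t) (p / 2) - spow a (p / 2)) ^ 2 = |a| ^ p * (spow t (p / 2) - 1) ^ 2 := by
  rw [spow_mul]
  linear_combination (spow t (p / 2) - 1) ^ 2 * spow_half_sq ha p

theorem one_add_mul_le_rpow_of_nonpos {y r : ℝ} (hy : 0 < y) (hr : r ≤ 0) :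
    1 + r * (y - 1) ≤ y ^ r := by
  rw [Real.rpow_def_of_pos hy]
  have h₁ := Real.add_one_le_exp (Real.log y * r)
  have h₂ := mul_le_mul_of_nonpos_right (Real.log_le_sub_one_of_pos hy) hr
  linarith

/-- For `y = t ^ (p / 2)`, the normalized divergence lies between `(y - 1) ^ 2` and
`(p - 1) * (y - 1) ^ 2`, in the order determined by the sign of `p - 2`. -/
theorem normalized_bregman_bounds {p y : ℝ} (hp : 1 < p) (hy : 0 < y) :
    min 1 (p - 1) * (y - 1) ^ 2 ≤ y ^ 2 - 1 - p * (y ^ (2 / p) - 1) ∧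
      y ^ 2 - 1 - p * (y ^ (2 / p) - 1) ≤ max 1 (p - 1) * (y - 1) ^ 2 := by
  have hp0 : 0 < p := by linarith
  have hps : p * (2 / p) = 2 := by field_simp
  have hsplit : y ^ (2 / p) = y * y ^ (2 / p - 1) := by
    rw [Real.rpow_sub_one hy.ne']
    field_simp
  have htangent : p * (1 + 2 / p * (y - 1)) = p + 2 * (y - 1) := by
    linear_combination (y - 1) * hps
  have hquad : p * (y * (1 + (2 / p - 1) * (y - 1))) = p * y + (2 - p) * (y ^ 2 - y) := by
    linear_combination y * (y - 1) * hps
  rcases le_total p 2 with h | h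
  · have hs1 : 1 ≤ 2 / p := (one_le_div hp0).2 h
    have hs2 : 2 / p ≤ 2 := (div_le_iff₀ hp0).2 (by linarith)
    have h₁ := one_add_mul_self_le_rpow_one_add (s := y - 1) (by linarith) hs1
    have h₂ := rpow_one_add_le_one_add_mul_self (s := y - 1) (p := 2 / p - 1)
      (by linarith) (by linarith) (by linarith)
    rw [add_sub_cancel] at h₁ h₂
    have h₁' := mul_le_mul_of_nonneg_left h₁ hp0.le
    have h₂' := mul_le_mul_of_nonneg_left (mul_le_mul_of_nonneg_left h₂ hy.le) hp0.le
    rw [← hsplit] at h₂'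
    rw [min_eq_right (by linarith), max_eq_left (by linarith)]
    constructor <;> linarith
  · have hs1 : 2 / p ≤ 1 := (div_le_one hp0).2 h
    have hs0 : 0 ≤ 2 / p := by positivity
    have h₁ := rpow_one_add_le_one_add_mul_self (s := y - 1) (by linarith) hs0 hs1
    rw [add_sub_cancel] at h₁
    have h₂ := one_add_mul_le_rpow_of_nonpos hy (r := 2 / p - 1) (by linarith)
    have h₁' := mul_le_mul_of_nonneg_left h₁ hp0.le
    have h₂' := mul_le_mul_of_nonneg_left (mul_le_mul_of_nonneg_left h₂ hy.le) hp0.le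
    rw [← hsplit] at h₂'
    rw [min_eq_left (by linarith), max_eq_right (by linarith)]
    constructor <;> linarith

theorem bregman_one_bounds {p : ℝ} (hp : 1 < p) (t : ℝ) :
    min 1 (p - 1) / 2 * (spow t (p / 2) - 1) ^ 2 ≤ |t| ^ p - 1 - p * (t - 1) ∧
      |t| ^ p - 1 - p * (t - 1) ≤ 2 * p * (spow t (p / 2) - 1) ^ 2 := by
  have hp0 : 0 < p := by linarith
  have hmin : 0 < min 1 (p - 1) := lt_min one_pos (by linarith)
  have hmin1 : min 1 (p - 1) ≤ 1 := min_le_left _ _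
  have hminp : min 1 (p - 1) ≤ p - 1 := min_le_right _ _
  rcases lt_trichotomy t 0 with ht | rfl | ht
  · have hsq := spow_half_sq ht.ne p
    have hy : spow t (p / 2) ≤ 0 := by
      rw [spow_of_neg ht]
      exact neg_nonpos.2 (Real.rpow_nonneg (by linarith) _)
    have hbound : -t ≤ 1 + |t| ^ p := by
      have hpow : 0 ≤ |t| ^ p := by positivity
      rcases le_total (-t) 1 with h | h
      · linarith
      · have := Real.self_le_rpow_of_one_le h hp.le
        rw [abs_of_neg ht] at hpow ⊢
        linarith
    rw [← hsq] at hbound ⊢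
    generalize spow t (p / 2) = y at *
    constructor
    · have h₁ : (y - 1) ^ 2 ≤ 2 * (y ^ 2 + 1) := by nlinarith [sq_nonneg (y + 1)]
      have h₂ := mul_le_mul_of_nonneg_left h₁ (half_pos hmin).le
      have h₃ := mul_le_mul_of_nonneg_right hmin1 (sq_nonneg y)
      have h₄ := mul_pos hp0 (neg_pos.2 ht)
      linarith
    · have h₁ := mul_le_mul_of_nonneg_left hbound hp0.le
      have h₂ := mul_nonneg hp0.le (neg_nonneg.2 hy)
      have h₃ := mul_nonneg (by linarith : 0 ≤ p - 1) (sq_nonneg y)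
      linarith
  · rw [spow_zero_left, abs_zero, Real.zero_rpow hp0.ne']
    constructor <;> linarith
  · have hy : 0 < t ^ (p / 2) := by positivity
    have hty : (t ^ (p / 2)) ^ (2 / p) = t := by
      rw [← Real.rpow_mul ht.le, show p / 2 * (2 / p) = 1 by field_simp, Real.rpow_one]
    have hsq := spow_half_sq ht.ne' p
    rw [← hsq, spow_of_pos ht]
    have hb := normalized_bregman_bounds hp hy
    rw [hty] at hb
    have hmax : max 1 (p - 1) ≤ 2 * p := max_le (by linarith) (by linarith)
    exact ⟨(mul_le_mul_of_nonneg_right (by linarith) (sq_nonneg _)).trans hb.1,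
      hb.2.trans (mul_le_mul_of_nonneg_right hmax (sq_nonneg _))⟩

theorem bregman_comparable_sq_diff_of_spow (p : ℝ) (hp : 1 < p) :
    ∃ c C : ℝ, 0 < c ∧ 0 < C ∧ ∀ a b : ℝ,
      c * (spow b (p / 2) - spow a (p / 2)) ^ 2 ≤ bregman p a b ∧
      bregman p a b ≤ C * (spow b (p / 2) - spow a (p / 2)) ^ 2 := by
  have hmin : 0 < min 1 (p - 1) := lt_min one_pos (by linarith)
  have hmin1 : min 1 (p - 1) ≤ 1 := min_le_left _ _
  refine ⟨min 1 (p - 1) / 2, 2 * p, by linarith, by linarith, fun a b => ?_⟩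
  rcases eq_or_ne a 0 with rfl | ha
  · have hF : bregman p 0 b = |b| ^ p := by
      simp [bregman, spow_zero_left, Real.zero_rpow (by linarith : p ≠ 0)]
    have hsq : spow b (p / 2) ^ 2 = |b| ^ p := by
      rcases eq_or_ne b 0 with rfl | hb
      · simp [spow_zero_left, Real.zero_rpow (by linarith : p ≠ 0)]
      · exact spow_half_sq hb p
    have hpow : 0 ≤ |b| ^ p := by positivity
    rw [hF, spow_zero_left, sub_zero, hsq]
    constructor <;> nlinarith
  · obtain ⟨t, rfl⟩ : ∃ t, b = a * t := ⟨b / a, by field_simp⟩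
    have hpow : 0 ≤ |a| ^ p := by positivity
    obtain ⟨hl, hu⟩ := bregman_one_bounds hp t
    rw [bregman_mul ha, sq_spow_half_mul_sub ha, mul_left_comm, mul_left_comm (2 * p)]
    exact ⟨mul_le_mul_of_nonneg_left hl hpow, mul_le_mul_of_nonneg_left hu hpow⟩
end

section
/- Let p ∈ (1,∞). Then (|x|^p − 1 − p(x−1)) / (x^{⟨p/2⟩} − 1)² tends to 1 as x → +∞, and also tends to 1 as x → −∞. -/
open Filter Topology

/-- Both limits at once: `s = 1` describes `x → +∞` and `s = -1` describes `x → -∞`,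
with `x = s * y`. -/
theorem tendsto_bregman_ratio_of_sq_eq_one {p s : ℝ} (hp : 1 < p) (hs : s ^ 2 = 1) :
    Tendsto (fun y : ℝ => (y ^ p - 1 - p * (s * y - 1)) / (y ^ (p / 2) * s - 1) ^ 2)
      atTop (𝓝 1) := by
  have h₁ := tendsto_rpow_neg_atTop (show 0 < p by linarith)
  have h₂ := tendsto_rpow_neg_atTop (show 0 < p - 1 by linarith)
  have h₃ := tendsto_rpow_neg_atTop (show 0 < p / 2 by linarith)
  have hnum : Tendsto (fun y : ℝ => 1 - y ^ (-p) - p * (s * y ^ (-(p - 1)) - y ^ (-p)))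
      atTop (𝓝 1) := by
    simpa using (h₁.const_sub 1).sub (((h₂.const_mul s).sub h₁).const_mul p)
  have hden : Tendsto (fun y : ℝ => (s - y ^ (-(p / 2))) ^ 2) atTop (𝓝 1) := by
    simpa [hs] using (h₃.const_sub s).pow 2
  have hlim := hnum.div hden one_ne_zero
  rw [div_one] at hlim
  refine hlim.congr' ?_
  filter_upwards [eventually_gt_atTop 0] with y hy
  have hpos : 0 < y ^ (p / 2) := Real.rpow_pos_of_pos hy _
  have hsq : y ^ p = (y ^ (p / 2)) ^ 2 := by
    rw [← Real.rpow_mul_natCast hy.le]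
    norm_num
  have hsub : y ^ (-(p - 1)) = y / y ^ p := by
    rw [neg_sub, Real.rpow_sub hy, Real.rpow_one]
  simp only [Pi.div_apply]
  rw [hsub, Real.rpow_neg hy.le, Real.rpow_neg hy.le, hsq,
    ← mul_div_mul_left _ _ (pow_pos hpos 2).ne']
  congr 1 <;> field_simp

theorem tendsto_bregman_ratio_atTop_atBot (p : ℝ) (hp : 1 < p) :
    Tendsto (fun x : ℝ => (|x| ^ p - 1 - p * (x - 1)) / (spow x (p / 2) - 1) ^ 2)
      atTop (𝓝 1) ∧
    Tendsto (fun x : ℝ => (|x| ^ p - 1 - p * (x - 1)) / (spow x (p / 2) - 1) ^ 2)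
      atBot (𝓝 1) := by
  constructor
  · refine (tendsto_bregman_ratio_of_sq_eq_one hp (one_pow 2)).congr' ?_
    filter_upwards [eventually_gt_atTop 0] with x hx
    rw [spow, abs_of_pos hx, Real.sign_of_pos hx, one_mul]
  · refine ((tendsto_bregman_ratio_of_sq_eq_one hp (s := -1) (by norm_num)).comp
      tendsto_neg_atBot_atTop).congr' ?_
    filter_upwards [eventually_lt_atBot 0] with x hx
    rw [spow, abs_of_neg hx, Real.sign_of_neg hx, Function.comp_apply, neg_one_mul, neg_neg]
end

section
/- Suppose f, g : E×E → [0,∞) are continuous, 0 ≤ f ≤ g, f = g = 0 on diag, and lim_{t→0⁺} (1/t) ∬_{E×E} g(x,y) μ_t(dx,dy) = ∬_{E×E∖diag} g(x,y) J(dx,dy) < ∞. Then lim_{t→0⁺} (1/t) ∬_{E×E} f(x,y) μ_t(dx,dy) = ∬_{E×E∖diag} f(x,y) J(dx,dy) < ∞. -/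
open MeasureTheory Filter Topology
open scoped ENNReal

/-- An open set in a second countable, locally compact metrizable space carries a sequence of
continuous compactly supported cutoffs with values in `[0, 1]`, eventually equal to `1` at each
point of the set. -/
lemma IsOpen.exists_seq_cutoff {X : Type*} [MetricSpace X] [LocallyCompactSpace X]
    [SecondCountableTopology X] {U : Set X} (hU : IsOpen U) :
    ∃ φ : ℕ → X → ℝ, (∀ n, Continuous (φ n)) ∧ (∀ n, HasCompactSupport (φ n)) ∧
      (∀ n, tsupport (φ n) ⊆ U) ∧ (∀ n x, φ n x ∈ Set.Icc (0 : ℝ) 1) ∧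
      ∀ x ∈ U, ∀ᶠ n in atTop, φ n x = 1 := by
  obtain ⟨F, hFc, hFU, hFun, hFmono⟩ := hU.exists_iUnion_isClosed
  let K := CompactExhaustion.choice X
  have key : ∀ n, ∃ φ : X → ℝ, Continuous φ ∧ HasCompactSupport φ ∧ tsupport φ ⊆ U ∧
      (∀ x, φ x ∈ Set.Icc (0 : ℝ) 1) ∧ ∀ x ∈ F n ∩ K n, φ x = 1 := by
    intro n
    have hC : IsCompact (F n ∩ K n) := (K.isCompact n).inter_left (hFc n)
    obtain ⟨V, hVo, hCV, hVU, -⟩ := exists_open_between_and_isCompact_closure hC hU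
      (Set.inter_subset_left.trans (hFU n))
    obtain ⟨φ, h1, h0, hφc, hφ⟩ := exists_continuous_one_zero_of_isCompact hC hVo.isClosed_compl
      (Set.disjoint_compl_right_iff_subset.2 hCV)
    have hsupp : tsupport φ ⊆ closure V := closure_mono fun x hx => by
      by_contra hxV
      exact hx (h0 hxV)
    exact ⟨φ, φ.continuous, hφc,
      hsupp.trans hVU, hφ, fun x hx => h1 hx⟩
  choose φ hφc hφs hφU hφ01 hφ1 using key
  refine ⟨φ, hφc, hφs, hφU, hφ01, fun x hx => ?_⟩
  rw [← hFun, Set.mem_iUnion] at hx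
  obtain ⟨m, hm⟩ := hx
  obtain ⟨k, hk⟩ := K.exists_mem x
  filter_upwards [eventually_ge_atTop m, eventually_ge_atTop k] with n hmn hkn
  exact hφ1 n x ⟨hFmono hmn hm, K.subset hkn hk⟩

/-- Lower semicontinuity of the integral under vague convergence on an open set `U` along a
filter, for nonnegative continuous functions that are integrable and vanish outside `U`. -/
lemma eventually_lt_integral_of_vague {X ι : Type*} [MetricSpace X] [LocallyCompactSpace X]
    [SecondCountableTopology X] [MeasurableSpace X] [BorelSpace X] {l : Filter ι}
    {c : ι → ℝ} (hc : ∀ᶠ t in l, 0 ≤ c t) {μ : ι → Measure X} {J : Measure X}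
    {U : Set X} (hU : IsOpen U)
    (hvague : ∀ φ : X → ℝ, Continuous φ → HasCompactSupport φ → tsupport φ ⊆ U →
      Tendsto (fun t => c t * ∫ x, φ x ∂(μ t)) l (𝓝 (∫ x, φ x ∂J)))
    {h : X → ℝ} (hcont : Continuous h) (h0 : ∀ x, 0 ≤ h x) (hzero : ∀ x ∉ U, h x = 0)
    (hJ : Integrable h J) (hμ : ∀ᶠ t in l, Integrable h (μ t)) {a : ℝ} (ha : a < ∫ x, h x ∂J) :
    ∀ᶠ t in l, a < c t * ∫ x, h x ∂(μ t) := by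
  obtain ⟨φ, hφc, hφs, hφU, hφ01, hφ1⟩ := hU.exists_seq_cutoff
  have hle : ∀ n x, φ n x * h x ≤ h x := fun n x =>
    mul_le_of_le_one_left (h0 x) (hφ01 n x).2
  have hnonneg : ∀ n x, 0 ≤ φ n x * h x := fun n x => mul_nonneg (hφ01 n x).1 (h0 x)
  have hlim : Tendsto (fun n => ∫ x, φ n x * h x ∂J) atTop (𝓝 (∫ x, h x ∂J)) := by
    refine tendsto_integral_of_dominated_convergence h
      (fun n => ((hφc n).mul hcont).aestronglyMeasurable) hJ
      (fun n => ae_of_all _ fun x => ?_) (ae_of_all _ fun x => ?_)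
    · rw [Real.norm_of_nonneg (hnonneg n x)]
      exact hle n x
    · by_cases hx : x ∈ U
      · refine tendsto_const_nhds.congr' ?_
        filter_upwards [hφ1 x hx] with n hn
        rw [hn, one_mul]
      · simp [hzero x hx]
  obtain ⟨n, hn⟩ := (hlim.eventually_const_lt ha).exists
  have hv := hvague (fun x => φ n x * h x) ((hφc n).mul hcont) ((hφs n).mul_right)
    ((tsupport_mul_subset_left).trans (hφU n))
  filter_upwards [hv.eventually_const_lt hn, hc, hμ] with t ht hct hμt
  refine ht.trans_le (mul_le_mul_of_nonneg_left ?_ hct)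
  exact integral_mono_of_nonneg (ae_of_all _ (hnonneg n)) hμt (ae_of_all _ (hle n))

theorem tendsto_of_dominated_vague
    {E : Type*} [MetricSpace E] [LocallyCompactSpace E]
    [TopologicalSpace.SeparableSpace E] [MeasurableSpace E] [BorelSpace E]
    (μ : ℝ → Measure (E × E)) (J : Measure (E × E))
    (hJdiag : J {z : E × E | z.1 = z.2} = 0)
    -- vague convergence (1/t)·μ_t → J on E×E∖diag as t → 0⁺:
    (hvague : ∀ φ : E × E → ℝ, Continuous φ → HasCompactSupport φ →
      tsupport φ ⊆ {z : E × E | z.1 ≠ z.2} →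
      Tendsto (fun t : ℝ => (1 / t) * ∫ z, φ z ∂(μ t)) (𝓝[>] (0 : ℝ))
        (𝓝 (∫ z, φ z ∂J)))
    (f g : E × E → ℝ) (hfcont : Continuous f) (hgcont : Continuous g)
    (hf0 : ∀ z, 0 ≤ f z) (hfg : ∀ z, f z ≤ g z)
    (hfdiag : ∀ z : E × E, z.1 = z.2 → f z = 0)
    (hgdiag : ∀ z : E × E, z.1 = z.2 → g z = 0)
    (hgfin : ∫⁻ z, ENNReal.ofReal (g z) ∂J < ⊤)
    (hgconv : Tendsto
      (fun t : ℝ => (ENNReal.ofReal t)⁻¹ * ∫⁻ z, ENNReal.ofReal (g z) ∂(μ t))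
      (𝓝[>] (0 : ℝ)) (𝓝 (∫⁻ z, ENNReal.ofReal (g z) ∂J))) :
    (∫⁻ z, ENNReal.ofReal (f z) ∂J < ⊤) ∧
    Tendsto (fun t : ℝ => (ENNReal.ofReal t)⁻¹ * ∫⁻ z, ENNReal.ofReal (f z) ∂(μ t))
      (𝓝[>] (0 : ℝ)) (𝓝 (∫⁻ z, ENNReal.ofReal (f z) ∂J)) := by
  have : SecondCountableTopology E := UniformSpace.secondCountable_of_separable E
  have integrable_of_le : ∀ {ν : Measure (E × E)} {u v : E × E → ℝ}, Continuous u →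
      (∀ z, 0 ≤ u z) → (∀ z, u z ≤ v z) → ∫⁻ z, ENNReal.ofReal (v z) ∂ν < ⊤ →
      Integrable u ν := by
    intro ν u v hu hu0 huv hv
    refine ⟨hu.aestronglyMeasurable, ?_⟩
    rw [hasFiniteIntegral_iff_ofReal (ae_of_all _ hu0)]
    exact (lintegral_mono fun z => ENNReal.ofReal_le_ofReal (huv z)).trans_lt hv
  have hg0 : ∀ z, 0 ≤ g z := fun z => (hf0 z).trans (hfg z)
  have hpos : ∀ᶠ t : ℝ in 𝓝[>] 0, 0 < t := eventually_mem_nhdsWithin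
  have hμfin : ∀ᶠ t in 𝓝[>] (0 : ℝ), ∫⁻ z, ENNReal.ofReal (g z) ∂(μ t) < ⊤ := by
    filter_upwards [hgconv.eventually_lt_const hgfin] with t ht
    by_contra hinf
    rw [not_lt_top_iff.1 hinf, ENNReal.mul_top (by simp)] at ht
    exact lt_irrefl _ ht
  have hfJ := integrable_of_le hfcont hf0 hfg hgfin
  have hgJ := integrable_of_le hgcont hg0 (fun _ => le_rfl) hgfin
  have scaled_eq : ∀ {u : E × E → ℝ}, (∀ z, 0 ≤ u z) → ∀ {t : ℝ}, 0 < t →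
      Integrable u (μ t) → (ENNReal.ofReal t)⁻¹ * ∫⁻ z, ENNReal.ofReal (u z) ∂(μ t) =
        ENNReal.ofReal ((1 / t) * ∫ z, u z ∂(μ t)) := by
    intro u hu0 t ht hu
    rw [← ofReal_integral_eq_lintegral_ofReal hu (ae_of_all _ hu0), one_div,
      ENNReal.ofReal_mul (inv_nonneg.2 ht.le), ENNReal.ofReal_inv_of_pos ht]
  have hgreal : Tendsto (fun t : ℝ => (1 / t) * ∫ z, g z ∂(μ t)) (𝓝[>] 0)
      (𝓝 (∫ z, g z ∂J)) := by
    have h := (ENNReal.tendsto_toReal hgfin.ne).comp hgconv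
    rw [← ofReal_integral_eq_lintegral_ofReal hgJ (ae_of_all _ hg0),
      ENNReal.toReal_ofReal (integral_nonneg hg0)] at h
    refine h.congr' ?_
    filter_upwards [hpos, hμfin] with t ht hfin
    rw [Function.comp_apply, scaled_eq hg0 ht (integrable_of_le hgcont hg0 (fun _ => le_rfl) hfin),
      ENNReal.toReal_ofReal (mul_nonneg (by positivity) (integral_nonneg hg0))]
  have hU : IsOpen {z : E × E | z.1 ≠ z.2} := isOpen_ne_fun continuous_fst continuous_snd
  have hc : ∀ᶠ t : ℝ in 𝓝[>] 0, 0 ≤ 1 / t := by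
    filter_upwards [hpos] with t ht
    positivity
  have hfμ : ∀ᶠ t in 𝓝[>] (0 : ℝ), Integrable f (μ t) :=
    hμfin.mono fun t ht => integrable_of_le hfcont hf0 hfg ht
  have hgμ : ∀ᶠ t in 𝓝[>] (0 : ℝ), Integrable g (μ t) :=
    hμfin.mono fun t ht => integrable_of_le hgcont hg0 (fun _ => le_rfl) ht
  have hfreal : Tendsto (fun t : ℝ => (1 / t) * ∫ z, f z ∂(μ t)) (𝓝[>] 0)
      (𝓝 (∫ z, f z ∂J)) := by
    refine tendsto_order.2 ⟨fun a ha => ?_, fun a ha => ?_⟩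
    · exact eventually_lt_integral_of_vague hc hU hvague hfcont hf0
        (fun z hz => hfdiag z (not_not.1 hz)) hfJ hfμ ha
    · obtain ⟨b, hfb, hba⟩ := exists_between ha
      have hlow := eventually_lt_integral_of_vague (h := fun z => g z - f z)
        (a := ∫ z, g z ∂J - b) hc hU hvague
        (hgcont.sub hfcont) (fun z => sub_nonneg.2 (hfg z))
        (fun z hz => by simp [hfdiag z (not_not.1 hz), hgdiag z (not_not.1 hz)]) (hgJ.sub hfJ)
        (by filter_upwards [hfμ, hgμ] with t h₁ h₂ using h₂.sub h₁)
        (by rw [integral_sub hgJ hfJ]; linarith)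
      have hup := hgreal.eventually_lt_const
        (show ∫ z, g z ∂J < (∫ z, g z ∂J) + (a - b) by linarith)
      filter_upwards [hlow, hup, hfμ, hgμ] with t h₁ h₂ h₃ h₄
      rw [integral_sub h₄ h₃, mul_sub] at h₁
      linarith
  refine ⟨(lintegral_mono fun z => ENNReal.ofReal_le_ofReal (hfg z)).trans_lt hgfin, ?_⟩
  rw [← ofReal_integral_eq_lintegral_ofReal hfJ (ae_of_all _ hf0)]
  refine (ENNReal.tendsto_ofReal hfreal).congr' ?_
  filter_upwards [hpos, hfμ] with t ht hfi
  exact (scaled_eq hf0 ht hfi).symm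
end
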